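/- arXiv:1907.03419 — 5 statements merged into one kernel-verified Lean document; each statement's English description precedes it below -/
import Mathlib

section
/- (Consistency of the interpretability measure, large-γ limit, first case.) Suppose the cost function satisfies 0 < c(m) ≤ c_max for all m ∈ M, for some constant c_max. Let m⁺, m⁻ ∈ M be models such that 𝒫(m⁺) and 𝒫(m⁻) are nonempty and ℒ_complexity(m⁺) < ℒ_complexity(m⁻), i.e., m⁺ requires strictly fewer interpretable steps than m⁻. Then ℒ_γ(m⁻) − ℒ_γ(m⁺) tends to +∞ as γ → +∞. -/
variable {M : Type*}

/-- `p` is an interpretable path from the base model `m₀` under step neighborhoods `S`: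
`m₁ ∈ S m₀` and `m_{k+1} ∈ S m_k`.  The empty list is the (unique) path of length 0. -/
def IsPath (S : M → Set M) (m₀ : M) (p : List M) : Prop :=
  List.Chain (fun a b => b ∈ S a) m₀ p

/-- The cost sequence of a path `p = (m_1, …, m_K)`: `costSeq c p k = c m_k` for `1 ≤ k ≤ K`
and `0` otherwise (in particular the value at the unused index `0` is `0`). -/
def costSeq (c : M → ℝ) (p : List M) : ℕ → ℝ :=
  fun k => ((0 : ℝ) :: p.map c).getD k 0

/-- Weighted-sum path interpretability loss `ℒ_α(p) = ∑_{k=1}^{|p|} α_k c(m_k)`. -/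
noncomputable def wLoss (c : M → ℝ) (α : ℕ → ℝ) (p : List M) : ℝ :=
  ∑ k ∈ Finset.Icc 1 p.length, α k * costSeq c p k

/-- Path interpretability loss `ℒ_γ(p) = ∑_{k=1}^{|p|} γ^k c(m_k)`. -/
noncomputable def gLoss (c : M → ℝ) (γ : ℝ) (p : List M) : ℝ :=
  ∑ k ∈ Finset.Icc 1 p.length, γ ^ k * costSeq c p k

/-- Model interpretability loss `ℒ_γ(m) = inf_{p ∈ 𝒫(m)} ℒ_γ(p)`. -/
noncomputable def modelLoss (c : M → ℝ) (S : M → Set M) (m₀ : M) (γ : ℝ) (m : M) : ℝ :=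
  sInf (gLoss c γ '' {p | IsPath S m₀ p ∧ p.getLastD m₀ = m})

/-- Model interpretability loss for general weights `α`. -/
noncomputable def modelWLoss (c : M → ℝ) (S : M → Set M) (m₀ : M) (α : ℕ → ℝ) (m : M) : ℝ :=
  sInf (wLoss c α '' {p | IsPath S m₀ p ∧ p.getLastD m₀ = m})

/-- Model complexity: the minimal length of an interpretable path leading to `m`. -/
noncomputable def modelComplexity (S : M → Set M) (m₀ : M) (m : M) : ℕ :=
  sInf (List.length '' {p | IsPath S m₀ p ∧ p.getLastD m₀ = m})

/-- Lexicographic order on real sequences: `u ≼ v` iff `u = v` or `u_K < v_K` at the first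
index `K` at which `u` and `v` differ. -/
def lexLE (u v : ℕ → ℝ) : Prop :=
  u = v ∨ ∃ K : ℕ, (∀ k < K, u k = v k) ∧ u K < v K

theorem costSeq_nonneg_aux (c : M → ℝ) (hc : ∀ m, 0 < c m) (p : List M) (k : ℕ) :
    0 ≤ costSeq c p k := by
  unfold costSeq
  rcases k with _ | k
  · simp
  · rw [List.getD_cons_succ, List.getD_eq_getElem?_getD, List.getElem?_map]
    cases p[k]? with
    | none => simp
    | some a => simpa using (hc a).le

theorem costSeq_le_aux (c : M → ℝ) (cmax : ℝ) (h0 : 0 ≤ cmax) (hc : ∀ m, c m ≤ cmax)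
    (p : List M) (k : ℕ) : costSeq c p k ≤ cmax := by
  unfold costSeq
  rcases k with _ | k
  · simpa using h0
  · rw [List.getD_cons_succ, List.getD_eq_getElem?_getD, List.getElem?_map]
    cases p[k]? with
    | none => simpa using h0
    | some a => simpa using hc a

theorem costSeq_last_aux (c : M → ℝ) (m₀ : M) (p : List M) (hp : 1 ≤ p.length) :
    costSeq c p p.length = c (p.getLastD m₀) := by
  rcases List.eq_nil_or_concat p with rfl | ⟨l, a, rfl⟩
  · simp at hp
  · simp [costSeq, List.getD_eq_getElem?_getD]

theorem gLoss_nonneg_aux (c : M → ℝ) (hc : ∀ m, 0 < c m) (γ : ℝ) (hγ : 0 ≤ γ) (p : List M) :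
    0 ≤ gLoss c γ p :=
  Finset.sum_nonneg fun k _ => mul_nonneg (pow_nonneg hγ k) (costSeq_nonneg_aux c hc p k)

theorem gLoss_le_aux (c : M → ℝ) (cmax : ℝ) (h0 : 0 ≤ cmax) (hc : ∀ m, c m ≤ cmax)
    (γ : ℝ) (hγ : 1 ≤ γ) (p : List M) :
    gLoss c γ p ≤ p.length * (γ ^ p.length * cmax) := by
  unfold gLoss
  have h := Finset.sum_le_card_nsmul (Finset.Icc 1 p.length)
    (fun k => γ ^ k * costSeq c p k) (γ ^ p.length * cmax) (by
      intro k hk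
      have hk2 := (Finset.mem_Icc.1 hk).2
      have h1 : γ ^ k ≤ γ ^ p.length := pow_le_pow_right₀ hγ hk2
      have h2 : 0 ≤ γ ^ k := by positivity
      exact (mul_le_mul_of_nonneg_left (costSeq_le_aux c cmax h0 hc p k) h2).trans
        (mul_le_mul_of_nonneg_right h1 h0))
  simpa using h

theorem le_gLoss_aux (c : M → ℝ) (hc : ∀ m, 0 < c m) (m₀ : M)
    (γ : ℝ) (hγ : 0 ≤ γ) (p : List M) (hp : 1 ≤ p.length) :
    γ ^ p.length * c (p.getLastD m₀) ≤ gLoss c γ p := by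
  rw [← costSeq_last_aux c m₀ p hp]
  exact Finset.single_le_sum (f := fun k => γ ^ k * costSeq c p k)
    (fun k _ => mul_nonneg (pow_nonneg hγ k) (costSeq_nonneg_aux c hc p k))
    (Finset.mem_Icc.2 ⟨hp, le_rfl⟩)

/-- (large-γ consistency, first case) if `ℒ_complexity(m⁺) < ℒ_complexity(m⁻)`,
then `ℒ_γ(m⁻) − ℒ_γ(m⁺) → +∞` as `γ → +∞`. -/
theorem model_loss_large_gamma_complexity (c : M → ℝ) (S : M → Set M) (m₀ : M) (cmax : ℝ)
    (hc : ∀ m, 0 < c m) (hcmax : ∀ m, c m ≤ cmax) (hS : ∀ m, (S m).Nonempty)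
    (mp mm : M)
    (hpne : {p : List M | IsPath S m₀ p ∧ p.getLastD m₀ = mp}.Nonempty)
    (hmne : {p : List M | IsPath S m₀ p ∧ p.getLastD m₀ = mm}.Nonempty)
    (hcomp : modelComplexity S m₀ mp < modelComplexity S m₀ mm) :
    Filter.Tendsto (fun γ : ℝ => modelLoss c S m₀ γ mm - modelLoss c S m₀ γ mp)
      Filter.atTop Filter.atTop := by
  have h0 : 0 ≤ cmax := (hc m₀).le.trans (hcmax m₀)
  obtain ⟨p, ⟨hp1, hp2⟩, hpl⟩ := Nat.sInf_mem (hpne.image List.length)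
  change p.length = modelComplexity S m₀ mp at hpl
  rw [← hpl] at hcomp
  have hT : Filter.Tendsto (fun γ : ℝ => γ * c mm - p.length * cmax)
      Filter.atTop Filter.atTop :=
    Filter.tendsto_atTop_add_const_right _ (-(p.length * cmax))
      (Filter.tendsto_id.atTop_mul_const (hc mm))
  refine Filter.tendsto_atTop_mono' _ ?_ hT
  filter_upwards [Filter.eventually_ge_atTop 1, hT.eventually_ge_atTop 0] with γ hγ hpos
  have hγ0 : (0 : ℝ) ≤ γ := zero_le_one.trans hγ
  have hup : modelLoss c S m₀ γ mp ≤ p.length * (γ ^ p.length * cmax) := by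
    refine le_trans (csInf_le ⟨0, ?_⟩ ⟨p, ⟨hp1, hp2⟩, rfl⟩) (gLoss_le_aux c cmax h0 hcmax γ hγ p)
    rintro _ ⟨q, _, rfl⟩
    exact gLoss_nonneg_aux c hc γ hγ0 q
  have hlo : γ ^ (p.length + 1) * c mm ≤ modelLoss c S m₀ γ mm := by
    refine le_csInf (hmne.image _) ?_
    rintro _ ⟨q, ⟨hq1, hq2⟩, rfl⟩
    have hq : modelComplexity S m₀ mm ≤ q.length := Nat.sInf_le ⟨q, ⟨hq1, hq2⟩, rfl⟩
    have h := le_gLoss_aux c hc m₀ γ hγ0 q (by omega)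
    rw [hq2] at h
    exact (mul_le_mul_of_nonneg_right (pow_le_pow_right₀ hγ (by omega)) (hc mm).le).trans h
  have h1 : 1 ≤ γ ^ p.length := one_le_pow₀ hγ
  have h2 := mul_le_mul_of_nonneg_right h1 hpos
  rw [pow_succ] at hlo
  linarith
end

section
/- (Consistency of the interpretability measure, large-γ limit, second case.) Suppose the cost function satisfies 0 < c(m) ≤ c_max for all m ∈ M, for some constant c_max. Let m⁺, m⁻ ∈ M be models such that 𝒫(m⁺) and 𝒫(m⁻) are nonempty, ℒ_complexity(m⁺) = ℒ_complexity(m⁻), and c(m⁺) < c(m⁻). Then ℒ_γ(m⁻) − ℒ_γ(m⁺) tends to +∞ as γ → +∞. -/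
variable {M : Type*}

theorem aux_costSeq_bounds (c : M → ℝ) (cmax : ℝ) (hc : ∀ m, 0 < c m) (hcmax : ∀ m, c m ≤ cmax)
    (hm : 0 ≤ cmax) (p : List M) (k : ℕ) : 0 ≤ costSeq c p k ∧ costSeq c p k ≤ cmax := by
  unfold costSeq
  cases k with
  | zero => simpa using hm
  | succ k =>
    rw [List.getD_cons_succ, List.getD_eq_getElem?_getD, List.getElem?_map]
    cases p[k]? with
    | none => simpa using hm
    | some a => simpa using ⟨(hc a).le, hcmax a⟩

theorem aux_gLoss_snoc (c : M → ℝ) (γ : ℝ) (q : List M) (x : M) :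
    gLoss c γ (q ++ [x]) = gLoss c γ q + γ ^ (q.length + 1) * c x := by
  unfold gLoss
  rw [List.length_append, List.length_singleton, Finset.sum_Icc_succ_top (by omega)]
  congr 1
  · refine Finset.sum_congr rfl fun k hk => ?_
    obtain ⟨h1, h2⟩ := Finset.mem_Icc.1 hk
    obtain ⟨j, rfl⟩ : ∃ j, k = j + 1 := ⟨k - 1, by omega⟩
    have hj : j < q.length := by omega
    simp [costSeq, List.getElem?_append_left, hj]
  · simp [costSeq]

theorem aux_gLoss_nonneg (c : M → ℝ) (cmax : ℝ) (hc : ∀ m, 0 < c m) (hcmax : ∀ m, c m ≤ cmax)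
    (hm : 0 ≤ cmax) (γ : ℝ) (hγ : 0 ≤ γ) (p : List M) : 0 ≤ gLoss c γ p :=
  Finset.sum_nonneg fun k _ =>
    mul_nonneg (pow_nonneg hγ k) (aux_costSeq_bounds c cmax hc hcmax hm p k).1

theorem aux_gLoss_le (c : M → ℝ) (cmax : ℝ) (hc : ∀ m, 0 < c m) (hcmax : ∀ m, c m ≤ cmax)
    (hm : 0 ≤ cmax) (γ : ℝ) (hγ : 1 ≤ γ) (p : List M) :
    gLoss c γ p ≤ p.length * (γ ^ p.length * cmax) := by
  have : gLoss c γ p ≤ ∑ k ∈ Finset.Icc 1 p.length, γ ^ p.length * cmax := by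
    refine Finset.sum_le_sum fun k hk => ?_
    have hb := aux_costSeq_bounds c cmax hc hcmax hm p k
    exact mul_le_mul (pow_le_pow_right₀ hγ (Finset.mem_Icc.1 hk).2) hb.2 hb.1 (by positivity)
  simpa using this

/-- (large-γ consistency, second case) if `ℒ_complexity(m⁺) = ℒ_complexity(m⁻)`
and `c(m⁺) < c(m⁻)`, then `ℒ_γ(m⁻) − ℒ_γ(m⁺) → +∞` as `γ → +∞`. -/
theorem model_loss_large_gamma_cost (c : M → ℝ) (S : M → Set M) (m₀ : M) (cmax : ℝ)
    (hc : ∀ m, 0 < c m) (hcmax : ∀ m, c m ≤ cmax) (hS : ∀ m, (S m).Nonempty)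
    (mp mm : M)
    (hpne : {p : List M | IsPath S m₀ p ∧ p.getLastD m₀ = mp}.Nonempty)
    (hmne : {p : List M | IsPath S m₀ p ∧ p.getLastD m₀ = mm}.Nonempty)
    (hcomp : modelComplexity S m₀ mp = modelComplexity S m₀ mm)
    (hcost : c mp < c mm) :
    Filter.Tendsto (fun γ : ℝ => modelLoss c S m₀ γ mm - modelLoss c S m₀ γ mp)
      Filter.atTop Filter.atTop := by
  have hm : 0 ≤ cmax := (hc m₀).le.trans (hcmax m₀)
  obtain ⟨p, ⟨hp, hpl⟩, hplen⟩ := Nat.sInf_mem (hpne.image List.length)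
  have hmin : ∀ r : List M, IsPath S m₀ r → r.getLastD m₀ = mm → p.length ≤ r.length := by
    intro r h1 h2
    rw [hplen]
    refine le_trans (le_of_eq hcomp) ?_
    exact Nat.sInf_le ⟨r, ⟨h1, h2⟩, rfl⟩
  have hpne0 : p ≠ [] := by
    rintro rfl
    obtain ⟨r, ⟨hr, hrl⟩, hrlen⟩ := Nat.sInf_mem (hmne.image List.length)
    have h0 : r.length = 0 := by
      rw [hrlen]
      refine (Eq.symm hcomp).trans ?_
      exact hplen.symm
    have : r = [] := List.length_eq_zero_iff.1 h0
    subst this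
    have : mp = mm := hpl.symm.trans hrl
    rw [this] at hcost
    exact lt_irrefl _ hcost
  rcases List.eq_nil_or_concat p with h | ⟨q, x, hq⟩
  · exact absurd h hpne0
  subst hq
  have hx : x = mp := by simpa using hpl
  subst hx
  set N := q.length with hN
  have hlow : ∀ γ : ℝ, 1 ≤ γ → γ ^ (N + 1) * c mm ≤ modelLoss c S m₀ γ mm := by
    intro γ hγ
    refine le_csInf (hmne.image _) ?_
    rintro _ ⟨r, ⟨hr, hrl⟩, rfl⟩
    have hlen := hmin r hr hrl
    rcases List.eq_nil_or_concat r with h | ⟨s, y, hs⟩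
    · subst h
      simp at hlen
    subst hs
    have hy : y = mm := by simpa using hrl
    subst hy
    simp only [List.concat_eq_append, List.length_append, List.length_singleton] at hlen
    rw [List.concat_eq_append, aux_gLoss_snoc]
    have h1 := aux_gLoss_nonneg c cmax hc hcmax hm γ (by linarith) s
    have h2 : γ ^ (N + 1) * c y ≤ γ ^ (s.length + 1) * c y :=
      mul_le_mul_of_nonneg_right (pow_le_pow_right₀ hγ hlen) (hc y).le
    linarith
  have hup : ∀ γ : ℝ, 1 ≤ γ →
      modelLoss c S m₀ γ x ≤ N * (γ ^ N * cmax) + γ ^ (N + 1) * c x := by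
    intro γ hγ
    have h1 : modelLoss c S m₀ γ x ≤ gLoss c γ (q.concat x) := by
      refine csInf_le ⟨0, ?_⟩ ⟨_, ⟨hp, hpl⟩, rfl⟩
      rintro _ ⟨r, _, rfl⟩
      exact aux_gLoss_nonneg c cmax hc hcmax hm γ (by linarith) r
    rw [List.concat_eq_append, aux_gLoss_snoc] at h1
    have h2 := aux_gLoss_le c cmax hc hcmax hm γ hγ q
    linarith
  have hd : 0 < c mm - c x := sub_pos.2 hcost
  have hlin : Filter.Tendsto (fun γ : ℝ => γ * (c mm - c x) + -(N * cmax))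
      Filter.atTop Filter.atTop :=
    Filter.tendsto_atTop_add_const_right _ _ (Filter.tendsto_id.atTop_mul_const hd)
  refine Filter.tendsto_atTop_mono' _ ?_ hlin
  filter_upwards [Filter.eventually_ge_atTop 1, hlin.eventually_ge_atTop 0] with γ hγ h0
  have h1 := hlow γ hγ
  have h2 := hup γ hγ
  have h3 := le_mul_of_one_le_left h0 (one_le_pow₀ hγ (n := N))
  have h4 : γ ^ N * (γ * (c mm - c x) + -(N * cmax)) =
      γ ^ (N + 1) * c mm - (N * (γ ^ N * cmax) + γ ^ (N + 1) * c x) := by ring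
  linarith
end

section
/- (Strict small-γ comparison from the proof of the consistency theorem.) Let p⁺ and p⁻ be interpretable paths whose cost sequences are distinct and such that the cost sequence of p⁺ strictly precedes the cost sequence of p⁻ in the lexicographic order (i.e., c(p⁺)_K < c(p⁻)_K at the first index K where the two cost sequences differ). Then there exists γ₀ > 0 such that for all γ with 0 < γ < γ₀, ℒ_γ(p⁺) < ℒ_γ(p⁻). -/
variable {M : Type*}

theorem gLoss_eq_range (c : M → ℝ) (γ : ℝ) (p : List M) (N : ℕ) (hN : p.length < N) :
    gLoss c γ p = ∑ k ∈ Finset.range N, γ ^ k * costSeq c p k := by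
  unfold gLoss
  apply Finset.sum_subset
  · intro k hk
    simp only [Finset.mem_Icc, Finset.mem_range] at *
    omega
  · intro k _ hk
    have h0 : costSeq c p k = 0 := by
      simp only [Finset.mem_Icc, not_and_or, not_le] at hk
      unfold costSeq
      rcases hk with hk | hk
      · have : k = 0 := by omega
        subst this
        simp
      · apply List.getD_eq_default
        simp
        omega
    rw [h0, mul_zero]

/-- (strict small-γ comparison) if the two cost sequences are distinct and
`c(p⁺)_K < c(p⁻)_K` at the first index `K` where they differ, then for all small enough
`γ > 0` one has `ℒ_γ(p⁺) < ℒ_γ(p⁻)`. -/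
theorem path_loss_small_gamma_strict (c : M → ℝ) (S : M → Set M) (m₀ : M)
    (hc : ∀ m, 0 < c m) (hS : ∀ m, (S m).Nonempty)
    (pp pm : List M) (hpp : IsPath S m₀ pp) (hpm : IsPath S m₀ pm)
    (hne : costSeq c pp ≠ costSeq c pm)
    (hlex : ∃ K : ℕ, (∀ k < K, costSeq c pp k = costSeq c pm k) ∧
      costSeq c pp K < costSeq c pm K) :
    ∃ γ₀ : ℝ, 0 < γ₀ ∧ ∀ γ : ℝ, 0 < γ → γ < γ₀ → gLoss c γ pp < gLoss c γ pm := by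
  obtain ⟨K, hK, hlt⟩ := hlex
  set N := pp.length + pm.length + 1 with hN
  set d : ℕ → ℝ := fun k => costSeq c pm k - costSeq c pp k with hd
  have hcont : Continuous (fun γ : ℝ => ∑ j ∈ Finset.range N, γ ^ j * d (K + j)) := by
    fun_prop
  have h0 : (0 : ℝ) < ∑ j ∈ Finset.range N, (0 : ℝ) ^ j * d (K + j) := by
    rw [hN, Finset.sum_range_succ']
    simp [hd, hlt]
  have hev := hcont.continuousAt.eventually (lt_mem_nhds h0)
  obtain ⟨ε, hε, h⟩ := Metric.eventually_nhds_iff.1 hev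
  refine ⟨ε, hε, fun γ hγ hγε => ?_⟩
  have hpos := h (y := γ) (by rw [Real.dist_eq, sub_zero, abs_of_pos hγ]; exact hγε)
  have key : gLoss c γ pm - gLoss c γ pp
      = γ ^ K * ∑ j ∈ Finset.range N, γ ^ j * d (K + j) := by
    rw [gLoss_eq_range c γ pm (K + N) (by omega), gLoss_eq_range c γ pp (K + N) (by omega),
      ← Finset.sum_sub_distrib, Finset.sum_range_add, Finset.mul_sum]
    rw [Finset.sum_eq_zero, zero_add]
    · refine Finset.sum_congr rfl fun j _ => ?_
      simp only [hd]
      ring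
    · intro k hk
      rw [hK k (Finset.mem_range.1 hk), sub_self]
  have := mul_pos (pow_pos hγ K) hpos
  linarith
end

section
/- (Key lower bound from the proof of the consistency theorem, equal lengths.) Suppose 0 < c(m) ≤ c_max for all m ∈ M and let γ ≥ 1. Let p⁺ and p⁻ be interpretable paths, both of length K ≥ 1, ending at models m⁺ and m⁻ respectively. Then ℒ_γ(p⁻) − ℒ_γ(p⁺) ≥ γ^{K} · ( (c(m⁻) − c(m⁺)) − c_max · ∑_{k=1}^{K−1} γ^{k−K} ). -/
variable {M : Type*}

theorem costSeq_bounds (c : M → ℝ) (cmax : ℝ) (hc : ∀ m, 0 < c m) (hcmax : ∀ m, c m ≤ cmax)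
    (p : List M) (k : ℕ) (h1 : 1 ≤ k) (h2 : k ≤ p.length) :
    0 ≤ costSeq c p k ∧ costSeq c p k ≤ cmax := by
  obtain ⟨j, rfl⟩ : ∃ j, k = j + 1 := ⟨k - 1, by omega⟩
  have hj : j < p.length := by omega
  have h : costSeq c p (j + 1) = c p[j] := by
    simp [costSeq, hj]
  rw [h]
  exact ⟨(hc _).le, hcmax _⟩

theorem costSeq_last (c : M → ℝ) (m₀ : M) (p : List M) (n : ℕ) (h : p.length = n + 1) :
    costSeq c p (n + 1) = c (p.getLastD m₀) := by
  have hn : n < p.length := by omega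
  have hne : p ≠ [] := by
    rintro rfl
    simp at h
  have h1 : costSeq c p (n + 1) = c p[n] := by
    simp [costSeq, hn]
  have h2 : p.getLastD m₀ = p[n] := by
    rw [List.getLastD_eq_getLast?, List.getLast?_eq_getElem?]
    simp [h]
  rw [h1, h2]

/-- (key lower bound, equal lengths) for `γ ≥ 1`, if `|p⁺| = |p⁻| = K ≥ 1` then
`ℒ_γ(p⁻) − ℒ_γ(p⁺) ≥ γ^K ((c(m⁻) − c(m⁺)) − c_max ∑_{k=1}^{K−1} γ^{k−K})`. -/
theorem gLoss_lower_bound_equal (c : M → ℝ) (S : M → Set M) (m₀ : M) (cmax γ : ℝ)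
    (hc : ∀ m, 0 < c m) (hcmax : ∀ m, c m ≤ cmax) (hγ : 1 ≤ γ)
    (K : ℕ) (hK : 1 ≤ K)
    (pp pm : List M) (hpp : IsPath S m₀ pp) (hpm : IsPath S m₀ pm)
    (hKp : pp.length = K) (hKm : pm.length = K)
    (mp mm : M) (hmp : pp.getLastD m₀ = mp) (hmm : pm.getLastD m₀ = mm) :
    γ ^ K * ((c mm - c mp) -
        cmax * ∑ k ∈ Finset.Icc 1 (K - 1), γ ^ ((k : ℤ) - (K : ℤ)))
      ≤ gLoss c γ pm - gLoss c γ pp := by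
  obtain ⟨n, rfl⟩ : ∃ n, K = n + 1 := ⟨K - 1, by omega⟩
  have h0 : (0 : ℝ) < γ := by linarith
  have e1 := costSeq_last c m₀ pp n hKp
  have e2 := costSeq_last c m₀ pm n hKm
  rw [hmp] at e1
  rw [hmm] at e2
  have hs : γ ^ (n + 1) * ∑ k ∈ Finset.Icc 1 n, γ ^ ((k : ℤ) - ((n + 1 : ℕ) : ℤ))
      = ∑ k ∈ Finset.Icc 1 n, γ ^ k := by
    rw [Finset.mul_sum]
    refine Finset.sum_congr rfl fun k _ => ?_
    rw [zpow_sub₀ h0.ne', zpow_natCast, zpow_natCast]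
    field_simp
  have b1 : ∑ k ∈ Finset.Icc 1 n, γ ^ k * costSeq c pp k
      ≤ (∑ k ∈ Finset.Icc 1 n, γ ^ k) * cmax := by
    rw [Finset.sum_mul]
    refine Finset.sum_le_sum fun k hk => ?_
    rw [Finset.mem_Icc] at hk
    exact mul_le_mul_of_nonneg_left
      (costSeq_bounds c cmax hc hcmax pp k hk.1 (by omega)).2 (by positivity)
  have b2 : 0 ≤ ∑ k ∈ Finset.Icc 1 n, γ ^ k * costSeq c pm k := by
    refine Finset.sum_nonneg fun k hk => ?_
    rw [Finset.mem_Icc] at hk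
    exact mul_nonneg (by positivity)
      (costSeq_bounds c cmax hc hcmax pm k hk.1 (by omega)).1
  unfold gLoss
  rw [hKp, hKm, Finset.sum_Icc_succ_top (by omega), Finset.sum_Icc_succ_top (by omega), e1, e2,
    Nat.add_sub_cancel]
  rw [← hs] at b1
  linarith
end

section
/- (Bound on the optimal path length, case γ > 1.) Suppose 0 < c_min ≤ c(m) ≤ c_max for all m ∈ M, and let λ > 0 and γ > 1. For K ≥ 0 define z_λ(K) = inf over interpretable paths p = (m_1, …, m_K) of length K of c(m_K) + λ·∑_{k=1}^K γ^k c(m_k), with z_λ(0) = c(m₀). Let K_max = log(1 + (γ − 1)·c_max / (λ·γ·c_min)) / log γ. Then for every K ≥ K_max, z_λ(K) ≥ z_λ(0); hence the minimization of z_λ(K) over K ≥ 0 may be restricted to K ≤ K_max. -/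
variable {M : Type*}

theorem aux_path_exists (S : M → Set M) (hS : ∀ m, (S m).Nonempty) (K : ℕ) :
    ∀ m₀ : M, ∃ p : List M, IsPath S m₀ p ∧ p.length = K := by
  induction K with
  | zero => exact fun m₀ => ⟨[], by simp [IsPath, List.Chain], rfl⟩
  | succ n ih =>
    intro m₀
    obtain ⟨m, hm⟩ := hS m₀
    obtain ⟨p, hp, hl⟩ := ih m
    refine ⟨m :: p, ?_, by simp [hl]⟩
    unfold IsPath List.Chain at *
    simp_all

theorem aux_costSeq (c : M → ℝ) (cmin : ℝ) (hc : ∀ m, cmin ≤ c m) (p : List M) (k : ℕ)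
    (hk : k ∈ Finset.Icc 1 p.length) : cmin ≤ costSeq c p k := by
  rw [Finset.mem_Icc] at hk
  obtain ⟨j, rfl⟩ : ∃ j, k = j + 1 := ⟨k - 1, by omega⟩
  have hj : j < p.length := by omega
  have : costSeq c p (j + 1) = c p[j] := by
    simp [costSeq, hj]
  rw [this]
  exact hc _

theorem aux_geom (γ : ℝ) (K : ℕ) :
    (∑ k ∈ Finset.Icc 1 K, γ ^ k) * (γ - 1) = γ * (γ ^ K - 1) := by
  induction K with
  | zero => simp
  | succ n ih =>
    rw [Finset.sum_Icc_succ_top (by omega), add_mul, ih]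
    ring

/-- (bound on optimal path length, `γ > 1`) with
`z_λ(K) = inf_{p ∈ 𝒫_K} (c(m_K) + λ ∑_{k=1}^K γ^k c(m_k))`, `z_λ(0) = c(m₀)`, and
`K_max = log(1 + (γ−1) c_max / (λ γ c_min)) / log γ`, for every `K ≥ K_max` one has
`z_λ(K) ≥ z_λ(0)`. -/
theorem optimal_length_bound_gamma_gt_one (c : M → ℝ) (S : M → Set M) (m₀ : M)
    (cmin cmax lam γ : ℝ) (hcmin : 0 < cmin)
    (hc : ∀ m, cmin ≤ c m) (hcmax : ∀ m, c m ≤ cmax)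
    (hlam : 0 < lam) (hγ : 1 < γ) (hS : ∀ m, (S m).Nonempty)
    (z : ℕ → ℝ)
    (hz : ∀ K : ℕ, z K = sInf {x : ℝ | ∃ p : List M, IsPath S m₀ p ∧ p.length = K ∧
      x = c (p.getLastD m₀) + lam * gLoss c γ p}) :
    ∀ K : ℕ,
      Real.log (1 + (γ - 1) * cmax / (lam * γ * cmin)) / Real.log γ ≤ (K : ℝ) →
      z 0 ≤ z K := by
  intro K hK
  have hγ0 : 0 < γ := by linarith
  have hcm : 0 < cmax := lt_of_lt_of_le hcmin ((hc m₀).trans (hcmax m₀))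
  have h0 : z 0 ≤ cmax := by
    rw [hz 0]
    have : {x : ℝ | ∃ p : List M, IsPath S m₀ p ∧ p.length = 0 ∧
      x = c (p.getLastD m₀) + lam * gLoss c γ p} = {c m₀} := by
      ext x
      constructor
      · rintro ⟨p, _, hl, rfl⟩
        obtain rfl := List.length_eq_zero_iff.mp hl
        simp [gLoss]
      · rintro rfl
        exact ⟨[], by simp [IsPath, List.Chain], rfl, by simp [gLoss]⟩
    rw [this, csInf_singleton]
    exact hcmax m₀
  refine h0.trans ?_
  rw [hz K]
  obtain ⟨q, hq, hql⟩ := aux_path_exists S hS K m₀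
  refine le_csInf ⟨_, q, hq, hql, rfl⟩ ?_
  rintro x ⟨p, _, hl, rfl⟩
  have hlast : 0 < c (p.getLastD m₀) := hcmin.trans_le (hc _)
  have hsum : cmin * ∑ k ∈ Finset.Icc 1 K, γ ^ k ≤ gLoss c γ p := by
    unfold gLoss
    rw [hl, Finset.mul_sum]
    refine Finset.sum_le_sum fun k hk => ?_
    rw [mul_comm]
    exact mul_le_mul_of_nonneg_left (aux_costSeq c cmin hc p k (hl ▸ hk)) (by positivity)
  have hγ1 : 0 < γ - 1 := by linarith
  have hpow : 1 + (γ - 1) * cmax / (lam * γ * cmin) ≤ γ ^ K := by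
    rw [div_le_iff₀ (Real.log_pos hγ), ← Real.log_pow] at hK
    exact (Real.log_le_log_iff (by positivity) (by positivity)).mp hK
  have h1 : (γ - 1) * cmax ≤ (γ ^ K - 1) * (lam * γ * cmin) := by
    rw [← div_le_iff₀ (by positivity)]
    linarith
  have h2 : cmax ≤ lam * (cmin * ∑ k ∈ Finset.Icc 1 K, γ ^ k) := by
    refine le_of_mul_le_mul_left ?_ hγ1
    calc _ ≤ _ := h1
      _ = lam * cmin * (γ * (γ ^ K - 1)) := by ring
      _ = _ := by rw [← aux_geom]; ring
  have h3 := mul_le_mul_of_nonneg_left hsum hlam.le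
  linarith
end
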